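/- Let n ≥ 1 and let X be a random vector in ℝⁿ. Then X is rotationally invariant (its distribution is invariant under every orthogonal linear map L : ℝⁿ → ℝⁿ) if and only if the distribution of X equals the scale mixture ω_n∘λ, where λ is the distribution of the Euclidean norm ‖X‖₂; that is, X has the same distribution as Θ·U, where U is uniform on the unit sphere S^{n-1}, Θ has the same distribution as ‖X‖₂, and Θ and U are independent. -/

import Mathlib

open MeasureTheory

/-- The scale mixture `μ ∘ λ`: the pushforward of `λ ⊗ μ` under `(s, x) ↦ s • x`. -/
noncomputable def scaleMix {E : Type*} [NormedAddCommGroup E] [NormedSpace ℝ E]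
    [MeasurableSpace E] (μ : Measure E) (l : Measure ℝ) : Measure E :=
  (l.prod μ).map (fun p : ℝ × E => p.1 • p.2)

/-- The uniform (i.e. rotation-invariant) probability measure `ω_n` on the unit sphere
`S^{n-1} ⊂ ℝⁿ`, viewed as a measure on `ℝⁿ`: the normalization of the spherical part
`volume.toSphere` of Lebesgue measure, pushed forward to the ambient space. -/
noncomputable def uniformOnSphere (n : ℕ) : Measure (EuclideanSpace ℝ (Fin n)) :=
  Measure.map Subtype.val
    ((((volume : Measure (EuclideanSpace ℝ (Fin n))).toSphere Set.univ)⁻¹ •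
      (volume : Measure (EuclideanSpace ℝ (Fin n))).toSphere))

open Metric Set
open scoped Pointwise RealInnerProductSpace

section Sphere

variable {E : Type*} [NormedAddCommGroup E] [InnerProductSpace ℝ E] [MeasurableSpace E] [BorelSpace E]

theorem map_coe_toSphere_apply (μ : Measure E) {A : Set E} (hA : MeasurableSet A) :
    μ.toSphere.map Subtype.val A
      = Module.finrank ℝ E * μ (Ioo (0 : ℝ) 1 • (A ∩ sphere 0 1)) := by
  rw [Measure.map_apply measurable_subtype_coe hA,
    μ.toSphere_apply' (measurable_subtype_coe hA), Subtype.image_preimage_coe, inter_comm]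

theorem map_map_coe_toSphere_volume [FiniteDimensional ℝ E] (L : E ≃ₗᵢ[ℝ] E) :
    ((volume : Measure E).toSphere.map Subtype.val).map L
      = (volume : Measure E).toSphere.map Subtype.val := by
  have hL : Measurable L := L.continuous.measurable
  ext A hA
  rw [Measure.map_apply hL hA, map_coe_toSphere_apply _ (hL hA), map_coe_toSphere_apply _ hA,
    ← L.measurePreserving.measure_preimage_emb L.toHomeomorph.measurableEmbedding
      (Ioo (0 : ℝ) 1 • (A ∩ sphere 0 1))]
  congr 2
  ext x
  simp only [mem_smul, mem_preimage, mem_inter_iff, mem_sphere_zero_iff_norm]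
  constructor
  · rintro ⟨r, hr, y, ⟨hyA, hy⟩, rfl⟩
    exact ⟨r, hr, L y, ⟨hyA, by rwa [L.norm_map]⟩, (L.map_smul r y).symm⟩
  · rintro ⟨r, hr, y, ⟨hyA, hy⟩, hx⟩
    refine ⟨r, hr, L.symm y, ⟨by simpa using hyA, by rwa [L.symm.norm_map]⟩, ?_⟩
    rw [← L.symm.map_smul, hx, L.symm_apply_apply]

end Sphere

theorem isProbabilityMeasure_uniformOnSphere {n : ℕ} (hn : 1 ≤ n) :
    IsProbabilityMeasure (uniformOnSphere n) := by
  have : Nonempty (Fin n) := ⟨⟨0, hn⟩⟩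
  have : NeZero (volume : Measure (EuclideanSpace ℝ (Fin n))).toSphere :=
    ⟨Measure.toSphere_ne_zero _⟩
  exact Measure.isProbabilityMeasure_map measurable_subtype_coe.aemeasurable

theorem map_uniformOnSphere {n : ℕ}
    (L : EuclideanSpace ℝ (Fin n) ≃ₗᵢ[ℝ] EuclideanSpace ℝ (Fin n)) :
    (uniformOnSphere n).map L = uniformOnSphere n := by
  rw [uniformOnSphere, Measure.map_smul, Measure.map_smul, map_map_coe_toSphere_volume]

theorem ae_norm_eq_one_uniformOnSphere (n : ℕ) : ∀ᵐ u ∂uniformOnSphere n, ‖u‖ = 1 := by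
  rw [uniformOnSphere, ae_map_iff measurable_subtype_coe.aemeasurable
    (measurableSet_eq_fun measurable_norm measurable_const)]
  exact .of_forall fun u => by simp

section Invariant

variable {E : Type*} [NormedAddCommGroup E] [InnerProductSpace ℝ E]
  [MeasurableSpace E] [BorelSpace E]

theorem charFun_eq_of_norm_eq {μ : Measure E} (hμ : ∀ L : E ≃ₗᵢ[ℝ] E, μ.map L = μ)
    {s t : E} (h : ‖s‖ = ‖t‖) : charFun μ s = charFun μ t := by
  obtain ⟨L, rfl⟩ : ∃ L : E ≃ₗᵢ[ℝ] E, L s = t := ⟨_, Submodule.reflection_sub h⟩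
  conv_rhs => rw [← hμ L]
  rw [charFun_apply, charFun_apply,
    integral_map_of_stronglyMeasurable L.continuous.measurable (by fun_prop)]
  simp

theorem integrable_exp_inner_prod [SecondCountableTopology E] {X : Type*} [MeasurableSpace X]
    (ρ : Measure X) [IsFiniteMeasure ρ] {f g : X → E} (hf : Measurable f) (hg : Measurable g) :
    Integrable (fun p => Complex.exp (⟪f p, g p⟫ * Complex.I)) ρ := by
  refine (integrable_const (1 : ℝ)).mono' (by fun_prop) (.of_forall fun p => ?_)
  rw [Complex.norm_exp_ofReal_mul_I]

theorem charFun_scaleMix [SecondCountableTopology E] (μ : Measure E) [IsFiniteMeasure μ]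
    (l : Measure ℝ) [IsFiniteMeasure l] (t : E) :
    charFun (scaleMix μ l) t = ∫ s, charFun μ (s • t) ∂l := by
  rw [scaleMix, charFun_apply,
    integral_map_of_stronglyMeasurable (by fun_prop) (by fun_prop), integral_prod]
  · simp only [charFun_apply, real_inner_smul_left, real_inner_smul_right]
  · exact integrable_exp_inner_prod _ (by fun_prop) measurable_const

theorem integral_charFun_smul [SecondCountableTopology E] (μ ν : Measure E) [IsFiniteMeasure μ]
    [IsFiniteMeasure ν] (c : ℝ) :
    ∫ u, charFun ν (c • u) ∂μ = ∫ x, charFun μ (c • x) ∂ν := by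
  simp only [charFun_apply]
  rw [integral_integral_swap]
  · simp only [real_inner_smul_right, real_inner_comm]
  · exact integrable_exp_inner_prod (μ.prod ν) (by fun_prop) (by fun_prop)

theorem map_scaleMix {μ : Measure E} [SFinite μ] {l : Measure ℝ} [SFinite l]
    [SecondCountableTopology E] (L : E ≃ₗᵢ[ℝ] E) :
    (scaleMix μ l).map L = scaleMix (μ.map L) l := by
  have hL : Measurable L := L.continuous.measurable
  have h := Measure.map_prod_map l μ measurable_id hL
  rw [Measure.map_id] at h
  rw [scaleMix, scaleMix, h, Measure.map_map hL (by fun_prop),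
    Measure.map_map (by fun_prop) (by fun_prop)]
  congr 1
  ext p
  simp

theorem eq_scaleMix_map_norm [SecondCountableTopology E] [CompleteSpace E]
    {ν ρ : Measure E} [IsFiniteMeasure ν] [IsProbabilityMeasure ρ]
    (hν : ∀ L : E ≃ₗᵢ[ℝ] E, ν.map L = ν) (hρ : ∀ L : E ≃ₗᵢ[ℝ] E, ρ.map L = ρ)
    (hρ₁ : ∀ᵐ u ∂ρ, ‖u‖ = 1) : ν = scaleMix ρ (ν.map norm) := by
  have : IsFiniteMeasure (scaleMix ρ (ν.map norm)) := by
    unfold scaleMix; infer_instance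
  refine Measure.ext_of_charFun (funext fun t => ?_)
  calc charFun ν t = ∫ u, charFun ν t ∂ρ := by simp
    _ = ∫ u, charFun ν (‖t‖ • u) ∂ρ := integral_congr_ae <| hρ₁.mono fun u hu =>
        charFun_eq_of_norm_eq hν (by simp [norm_smul, hu])
    _ = ∫ x, charFun ρ (‖t‖ • x) ∂ν := integral_charFun_smul _ _ _
    _ = ∫ x, charFun ρ (‖x‖ • t) ∂ν := integral_congr_ae <| .of_forall fun x =>
        charFun_eq_of_norm_eq hρ (by simp [norm_smul, mul_comm])
    _ = ∫ s, charFun ρ (s • t) ∂(ν.map norm) := by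
        rw [integral_map_of_stronglyMeasurable measurable_norm]
        exact stronglyMeasurable_charFun.comp_measurable (by fun_prop)
    _ = charFun (scaleMix ρ (ν.map norm)) t := (charFun_scaleMix _ _ _).symm

end Invariant

/-- A random vector `X` in `ℝⁿ` is rotationally invariant iff its law is the scale
mixture `ω_n ∘ λ` where `λ` is the law of the Euclidean norm `‖X‖₂`, i.e. iff
`X ≐ Θ • U` with `U` uniform on `S^{n-1}`, `Θ ≐ ‖X‖₂`, `Θ, U` independent. -/
theorem rotationInvariant_iff_scaleMix_sphere
    {n : ℕ} (hn : 1 ≤ n)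
    {Ω : Type*} [MeasurableSpace Ω] (P : Measure Ω) [IsProbabilityMeasure P]
    (X : Ω → EuclideanSpace ℝ (Fin n)) (hX : Measurable X) :
    (∀ L : EuclideanSpace ℝ (Fin n) ≃ₗᵢ[ℝ] EuclideanSpace ℝ (Fin n),
        Measure.map (fun ω => L (X ω)) P = Measure.map X P)
      ↔
    Measure.map X P =
      scaleMix (uniformOnSphere n) (Measure.map (fun ω => ‖X ω‖) P) := by
  have := isProbabilityMeasure_uniformOnSphere hn
  have := Measure.isProbabilityMeasure_map (μ := P) hX.aemeasurable
  have hmap (L : EuclideanSpace ℝ (Fin n) ≃ₗᵢ[ℝ] EuclideanSpace ℝ (Fin n)) :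
      P.map (fun ω => L (X ω)) = (P.map X).map L :=
    (Measure.map_map L.continuous.measurable hX).symm
  have hnorm : P.map (fun ω => ‖X ω‖) = (P.map X).map norm :=
    (Measure.map_map measurable_norm hX).symm
  simp only [hmap, hnorm]
  refine ⟨fun h => eq_scaleMix_map_norm h map_uniformOnSphere
    (ae_norm_eq_one_uniformOnSphere n), fun h L => ?_⟩
  rw [h, map_scaleMix, map_uniformOnSphere]
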